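/- Let σ ∈ ℝ, a ∈ ℝ, let m, n be positive integers and μ, ν > 0 with m − ν = n − μ. Let r = max(m,n) and suppose f : [a,∞) → ℝ is (r−1)-times continuously differentiable on (a,∞) with its r-th derivative integrable on every finite subinterval of [a,∞). Then for all x > a, D_s^n[I_s^μ f](x) = D_s^m[I_s^ν f](x). -/

import Mathlib

open MeasureTheory Set

/-- The fractional substantial integral of order `ν` with lower terminal `a`. -/
noncomputable def Isub (σ a ν : ℝ) (f : ℝ → ℝ) : ℝ → ℝ :=
  fun x => (1 / Real.Gamma ν) * ∫ τ in a..x, (x - τ) ^ (ν - 1) * Real.exp (-σ * (x - τ)) * f τ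

/-- The substantial derivative operator `D_s f = f′ + σ f`. -/
noncomputable def Dsub (σ : ℝ) (f : ℝ → ℝ) : ℝ → ℝ := fun x => deriv f x + σ * f x

/-- The Riemann–Liouville type integral `∫ τ in a..x, (x - τ) ^ (ν - 1) * g τ`,
without the Gamma factor. -/
noncomputable def rpowKernelIntegral (a ν : ℝ) (g : ℝ → ℝ) (x : ℝ) : ℝ :=
  ∫ τ in a..x, (x - τ) ^ (ν - 1) * g τ

theorem intervalIntegrable_of_continuousOn_Ioi {a c y : ℝ} {g : ℝ → ℝ}
    (hg : ContinuousOn g (Ioi a)) (hc : a < c) (hac : IntervalIntegrable g volume a c)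
    (hy : a < y) : IntervalIntegrable g volume a y :=
  hac.trans ((hg.mono fun _ ht => (lt_min hc hy).trans_le ht.1).intervalIntegrable)

theorem intervalIntegrable_sub_rpow {ν : ℝ} (hν : 0 < ν) (x b c : ℝ) :
    IntervalIntegrable (fun τ => (x - τ) ^ (ν - 1)) volume b c := by
  have h := (intervalIntegral.intervalIntegrable_rpow' (a := x - b) (b := x - c)
    (show -1 < ν - 1 by linarith)).comp_sub_left x
  simpa using h

/-- On an interval ending strictly before `x`, the kernel is harmless. -/
theorem intervalIntegrable_sub_rpow_mul_left {a c x ν : ℝ} {g : ℝ → ℝ}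
    (hac : a ≤ c) (hcx : c < x) (hg : IntervalIntegrable g volume a c) :
    IntervalIntegrable (fun τ => (x - τ) ^ (ν - 1) * g τ) volume a c := by
  refine hg.continuousOn_mul ?_
  rw [uIcc_of_le hac]
  exact ContinuousOn.rpow_const (by fun_prop) fun t ht => Or.inl (by linarith [ht.2])

theorem intervalIntegrable_sub_rpow_mul_right {c x ν : ℝ} {g : ℝ → ℝ} (hν : 0 < ν)
    (hg : ContinuousOn g (uIcc c x)) :
    IntervalIntegrable (fun τ => (x - τ) ^ (ν - 1) * g τ) volume c x :=
  (intervalIntegrable_sub_rpow hν x c x).mul_continuousOn hg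

theorem continuousAt_rpowKernelIntegral {a ν : ℝ} {g : ℝ → ℝ} (hν : 0 < ν)
    (hg : ContinuousOn g (Ioi a)) (hint : ∀ y > a, IntervalIntegrable g volume a y)
    {x₀ : ℝ} (hx₀ : a < x₀) : ContinuousAt (rpowKernelIntegral a ν g) x₀ := by
  obtain ⟨c, hac, hcx⟩ := exists_between hx₀
  obtain ⟨d, hcd, hdx⟩ := exists_between hcx
  have hcM : c ≤ x₀ + 1 := by linarith
  set h : ℝ → ℝ := IccExtend hcM ((Icc c (x₀ + 1)).domRestrict g) with h_def
  have hcont : ContinuousOn g (Icc c (x₀ + 1)) := hg.mono fun t ht => hac.trans_le ht.1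
  have h_cont : Continuous h := (continuousOn_iff_continuous_domRestrict.1 hcont).Icc_extend'
  obtain ⟨B, hB⟩ := (isCompact_Icc (a := c) (b := x₀ + 1)).exists_bound_of_continuousOn hcont
  have h_bdd : ∀ t, ‖h t‖ ≤ B := fun t => hB _ (projIcc c (x₀ + 1) hcM t).2
  have hsplit : ∀ᶠ x in nhds x₀, rpowKernelIntegral a ν g x =
      (∫ τ in a..c, (x - τ) ^ (ν - 1) * g τ) + ∫ s in (0 : ℝ)..(x - c), s ^ (ν - 1) * h (x - s) := by
    filter_upwards [Ioo_mem_nhds hcx (show x₀ < x₀ + 1 by linarith)] with x hx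
    have hsub : uIcc c x ⊆ Icc c (x₀ + 1) := by
      rw [uIcc_of_le hx.1.le]; exact Icc_subset_Icc_right hx.2.le
    rw [rpowKernelIntegral, ← intervalIntegral.integral_add_adjacent_intervals
      (intervalIntegrable_sub_rpow_mul_left hac.le hx.1 (hint c hac))
      (intervalIntegrable_sub_rpow_mul_right hν (hcont.mono hsub))]
    congr 1
    have key := intervalIntegral.integral_comp_sub_left
      (fun s => s ^ (ν - 1) * h (x - s)) x (a := c) (b := x)
    rw [sub_self] at key
    rw [← key]
    refine intervalIntegral.integral_congr fun t ht => ?_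
    simp only [sub_sub_cancel]
    rw [h_def, IccExtend_of_mem _ _ (hsub ht)]
    rfl
  refine ContinuousAt.congr ?_ (hsplit.mono fun _ h => h.symm)
  refine ContinuousAt.add ?_ ?_
  · obtain ⟨C, hC⟩ := (isCompact_Icc (a := d - c) (b := x₀ + 1 - a)).exists_bound_of_continuousOn
      (f := fun s : ℝ => s ^ (ν - 1))
      (ContinuousOn.rpow_const (by fun_prop) fun t ht => Or.inl (by linarith [ht.1]))
    refine intervalIntegral.continuousAt_of_dominated_interval (bound := fun τ => C * ‖g τ‖) ?_ ?_
      ((hint c hac).norm.const_mul C) ?_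
    · filter_upwards [Ioi_mem_nhds hcx] with x hx
      exact (intervalIntegrable_sub_rpow_mul_left hac.le hx
        (hint c hac)).def'.aestronglyMeasurable
    · filter_upwards [Ioo_mem_nhds hdx (show x₀ < x₀ + 1 by linarith)] with x hx
      refine Filter.Eventually.of_forall fun τ hτ => ?_
      rw [uIoc_of_le hac.le] at hτ
      rw [norm_mul]
      exact mul_le_mul_of_nonneg_right
        (hC _ ⟨by linarith [hx.1, hτ.2], by linarith [hx.2, hτ.1]⟩) (norm_nonneg _)
    · refine Filter.Eventually.of_forall fun τ hτ => ?_
      rw [uIoc_of_le hac.le] at hτ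
      have : x₀ - τ ≠ 0 := by linarith [hτ.2]
      exact ((continuousAt_id.sub continuousAt_const).rpow_const (Or.inl this)).mul
        continuousAt_const
  · have hF := intervalIntegral.continuousAt_parametric_primitive_of_dominated
      (μ := volume) (F := fun x s : ℝ => s ^ (ν - 1) * h (x - s))
      (fun s => ‖s ^ (ν - 1)‖ * B) (-1) (x₀ - c + 1) (a₀ := 0) (b₀ := x₀ - c) (x₀ := x₀)
      (fun x => ((intervalIntegral.intervalIntegrable_rpow' (r := ν - 1)
        (by linarith)).mul_continuousOn (g := fun s => h (x - s))
        (by fun_prop)).def'.aestronglyMeasurable)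
      (Filter.Eventually.of_forall fun x => Filter.Eventually.of_forall fun s => by
        rw [norm_mul]
        exact mul_le_mul_of_nonneg_left (h_bdd _) (norm_nonneg _))
      ((intervalIntegral.intervalIntegrable_rpow' (by linarith)).norm.mul_const B)
      (Filter.Eventually.of_forall fun s => by fun_prop)
      ⟨by linarith, by linarith⟩ ⟨by linarith, by linarith⟩ (by simp)
    exact ContinuousAt.comp (f := fun x : ℝ => (x, x - c)) hF (by fun_prop)

theorem rpowKernelIntegral_add_one {a ν : ℝ} {g : ℝ → ℝ} (hν : 0 < ν)
    {x : ℝ} (hx : a < x) (hint : IntervalIntegrable g volume a x) :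
    IntervalIntegrable (rpowKernelIntegral a ν g) volume a x ∧
      rpowKernelIntegral a (ν + 1) g x = ν * ∫ t in a..x, rpowKernelIntegral a ν g t := by
  set G : ℝ → ℝ := (Ioc a x).indicator g
  set k : ℝ → ℝ := (Ioc 0 (x - a)).indicator fun s => s ^ (ν - 1)
  have hG : Integrable G :=
    (integrable_indicator_iff measurableSet_Ioc).2
      ((intervalIntegrable_iff_integrableOn_Ioc_of_le hx.le).1 hint)
  have hk : Integrable k := (integrable_indicator_iff measurableSet_Ioc).2
    ((intervalIntegrable_iff_integrableOn_Ioc_of_le (by linarith)).1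
      (intervalIntegral.intervalIntegrable_rpow' (by linarith)))
  have hprod : Integrable (fun p : ℝ × ℝ => G p.2 * k (p.1 - p.2))
      ((volume.restrict (Ioc a x)).prod volume) := by
    have h := hG.convolution_integrand (ContinuousLinearMap.mul ℝ ℝ) hk
    refine h.mono_measure ?_
    exact Measure.prod_mono Measure.restrict_le_self le_rfl
  have hinner : ∀ t ∈ Ioc a x, ∫ τ, G τ * k (t - τ) = rpowKernelIntegral a ν g t := by
    intro t ht
    rw [rpowKernelIntegral, intervalIntegral.integral_of_le ht.1.le, integral_Ioc_eq_integral_Ioo,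
      ← integral_indicator measurableSet_Ioo]
    congr 1
    ext τ
    by_cases hτ : τ ∈ Ioo a t
    · have h1 : τ ∈ Ioc a x := ⟨hτ.1, hτ.2.le.trans ht.2⟩
      have h2 : t - τ ∈ Ioc 0 (x - a) := ⟨by linarith [hτ.2], by linarith [hτ.1, ht.2]⟩
      simp only [G, k, indicator_of_mem hτ, indicator_of_mem h1, indicator_of_mem h2]
      ring
    · rw [indicator_of_notMem hτ]
      by_cases h1 : τ ∈ Ioc a x
      · have h2 : t - τ ∉ Ioc 0 (x - a) := fun h => hτ ⟨h1.1, by linarith [h.1]⟩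
        simp [k, indicator_of_notMem h2]
      · simp [G, indicator_of_notMem h1]
  have houter : ∀ τ, ν * ∫ t in Ioc a x, G τ * k (t - τ) =
      (Ioc a x).indicator (fun τ => (x - τ) ^ (ν + 1 - 1) * g τ) τ := by
    intro τ
    by_cases hτ : τ ∈ Ioc a x
    · rw [integral_const_mul, indicator_of_mem hτ]
      have h1 : ∫ t in Ioc a x, k (t - τ) = ∫ t in τ..x, (t - τ) ^ (ν - 1) := by
        rw [intervalIntegral.integral_of_le hτ.2, ← integral_indicator measurableSet_Ioc,
          ← integral_indicator measurableSet_Ioc]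
        congr 1
        ext t
        by_cases ht : t ∈ Ioc τ x
        · have h2 : t ∈ Ioc a x := ⟨hτ.1.trans ht.1, ht.2⟩
          have h3 : t - τ ∈ Ioc 0 (x - a) := ⟨by linarith [ht.1], by linarith [hτ.1, ht.2]⟩
          simp only [k, indicator_of_mem ht, indicator_of_mem h2, indicator_of_mem h3]
        · rw [indicator_of_notMem ht]
          by_cases h2 : t ∈ Ioc a x
          · have h3 : t - τ ∉ Ioc 0 (x - a) := fun h => ht ⟨by linarith [h.1], h2.2⟩
            rw [indicator_of_mem h2]
            simp [k, indicator_of_notMem h3]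
          · rw [indicator_of_notMem h2]
      rw [h1, intervalIntegral.integral_comp_sub_right (fun s => s ^ (ν - 1)), sub_self,
        integral_rpow (Or.inl (by linarith))]
      simp only [G, indicator_of_mem hτ, sub_add_cancel, add_sub_cancel_right,
        Real.zero_rpow hν.ne', sub_zero]
      field_simp
    · simp [G, indicator_of_notMem hτ]
  refine ⟨?_, ?_⟩
  · rw [intervalIntegrable_iff_integrableOn_Ioc_of_le hx.le]
    exact hprod.integral_prod_left.congr
      ((ae_restrict_iff' measurableSet_Ioc).2 (Filter.Eventually.of_forall hinner))
  · rw [intervalIntegral.integral_of_le hx.le, ← setIntegral_congr_fun measurableSet_Ioc hinner,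
      integral_integral_swap hprod, ← integral_const_mul, rpowKernelIntegral,
      intervalIntegral.integral_of_le hx.le, ← integral_indicator measurableSet_Ioc]
    exact (integral_congr_ae (Filter.Eventually.of_forall houter)).symm

theorem hasDerivAt_rpowKernelIntegral {a ν : ℝ} {g : ℝ → ℝ} (hν : 0 < ν)
    (hg : ContinuousOn g (Ioi a)) (hint : ∀ y > a, IntervalIntegrable g volume a y)
    {x : ℝ} (hx : a < x) :
    HasDerivAt (rpowKernelIntegral a (ν + 1) g) (ν * rpowKernelIntegral a ν g x) x := by
  have hcont : ∀ y ∈ Ioi a, ContinuousAt (rpowKernelIntegral a ν g) y := fun y hy =>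
    continuousAt_rpowKernelIntegral hν hg hint hy
  have hderiv := (intervalIntegral.integral_hasDerivAt_right
    (rpowKernelIntegral_add_one hν hx (hint x hx)).1
    (ContinuousAt.stronglyMeasurableAtFilter isOpen_Ioi hcont x hx) (hcont x hx)).const_mul ν
  refine hderiv.congr_of_eventuallyEq ?_
  filter_upwards [Ioi_mem_nhds hx] with y hy
  exact (rpowKernelIntegral_add_one hν hy (hint y hy)).2

theorem Isub_eq_rpowKernelIntegral (σ a ν : ℝ) (f : ℝ → ℝ) (x : ℝ) :
    Isub σ a ν f x = 1 / Real.Gamma ν *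
      (Real.exp (-σ * x) * rpowKernelIntegral a ν (fun τ => Real.exp (σ * τ) * f τ) x) := by
  rw [Isub, rpowKernelIntegral, ← intervalIntegral.integral_const_mul (Real.exp _)]
  congr 1
  refine intervalIntegral.integral_congr fun τ _ => ?_
  rw [show -σ * (x - τ) = -σ * x + σ * τ by ring, Real.exp_add]
  ring

/-- If `f` is not integrable near `a`, the substantial integral takes its junk value. -/
theorem Isub_eq_zero_of_not_intervalIntegrable {σ a ν : ℝ} {f : ℝ → ℝ}
    (h : ∀ c > a, ¬ IntervalIntegrable f volume a c) {x : ℝ} (hx : a < x) :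
    Isub σ a ν f x = 0 := by
  rw [Isub, intervalIntegral.integral_undef, mul_zero]
  intro hI
  obtain ⟨c, hac, hcx⟩ := exists_between hx
  have hI' := hI.mono_set (show uIcc a c ⊆ uIcc a x by
    rw [uIcc_of_le hac.le, uIcc_of_le hx.le]; exact Icc_subset_Icc_right hcx.le)
  have hpos : ∀ τ ∈ Icc a c, 0 < x - τ := fun τ hτ => by linarith [hτ.2]
  refine h c hac ((hI'.continuousOn_mul
    (g := fun τ => ((x - τ) ^ (ν - 1) * Real.exp (-σ * (x - τ)))⁻¹) ?_).congr ?_)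
  · rw [uIcc_of_le hac.le]
    refine ContinuousOn.inv₀ (ContinuousOn.mul (ContinuousOn.rpow_const (by fun_prop)
      fun t ht => Or.inl (hpos t ht).ne') (by fun_prop)) fun t ht => ?_
    have := hpos t ht
    positivity
  · intro τ hτ
    rw [uIoc_of_le hac.le] at hτ
    have := hpos τ ⟨hτ.1.le, hτ.2⟩
    have h1 := (Real.rpow_pos_of_pos this (ν - 1)).ne'
    have h2 := (Real.exp_pos (-σ * (x - τ))).ne'
    simp only
    field_simp

theorem Dsub_Isub_add_one {σ a ν : ℝ} {f : ℝ → ℝ} (hν : 0 < ν) (hf : ContinuousOn f (Ioi a)) :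
    EqOn (Dsub σ (Isub σ a (ν + 1) f)) (Isub σ a ν f) (Ioi a) := by
  intro x hx
  by_cases h : ∃ c > a, IntervalIntegrable f volume a c
  · obtain ⟨c, hc, hfc⟩ := h
    have hexp : Continuous fun τ : ℝ => Real.exp (σ * τ) := by fun_prop
    have hD := hasDerivAt_rpowKernelIntegral (g := fun τ => Real.exp (σ * τ) * f τ) hν
      (hexp.continuousOn.mul hf)
      (fun y hy => (intervalIntegrable_of_continuousOn_Ioi hf hc hfc hy).continuousOn_mul
        hexp.continuousOn) hx
    have hE : HasDerivAt (fun y => Real.exp (-σ * y)) (Real.exp (-σ * x) * (-σ * 1)) x :=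
      ((hasDerivAt_id x).const_mul (-σ)).exp
    have hI := (hE.mul hD).const_mul (1 / Real.Gamma (ν + 1))
    have hfun : Isub σ a (ν + 1) f = fun y => 1 / Real.Gamma (ν + 1) * (Real.exp (-σ * y) *
        rpowKernelIntegral a (ν + 1) (fun τ => Real.exp (σ * τ) * f τ) y) :=
      funext (Isub_eq_rpowKernelIntegral σ a (ν + 1) f)
    have hI' : HasDerivAt (Isub σ a (ν + 1) f) _ x := hfun ▸ hI
    rw [Dsub, hI'.deriv, Isub_eq_rpowKernelIntegral, Isub_eq_rpowKernelIntegral, Real.Gamma_add_one hν.ne']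
    have := (Real.Gamma_pos_of_pos hν).ne'
    field_simp
    ring
  · push Not at h
    have hzero : Isub σ a (ν + 1) f =ᶠ[nhds x] fun _ => 0 := by
      filter_upwards [Ioi_mem_nhds hx] with y hy
      exact Isub_eq_zero_of_not_intervalIntegrable h hy
    rw [Dsub, hzero.deriv_eq, hzero.eq_of_nhds, Isub_eq_zero_of_not_intervalIntegrable h hx]
    simp

theorem eqOn_iterate_Dsub {σ : ℝ} {F G : ℝ → ℝ} {s : Set ℝ} (hs : IsOpen s) (h : EqOn F G s)
    (m : ℕ) : EqOn ((Dsub σ)^[m] F) ((Dsub σ)^[m] G) s := by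
  induction m with
  | zero => exact h
  | succ m ih =>
    intro x hx
    rw [Function.iterate_succ_apply', Function.iterate_succ_apply', Dsub, Dsub, ih hx,
      (ih.eventuallyEq_of_mem (hs.mem_nhds hx)).deriv_eq]

theorem iterate_Dsub_Isub_add_natCast {σ a ν : ℝ} {f : ℝ → ℝ} (hν : 0 < ν)
    (hf : ContinuousOn f (Ioi a)) (k : ℕ) :
    EqOn ((Dsub σ)^[k] (Isub σ a (ν + k) f)) (Isub σ a ν f) (Ioi a) := by
  induction k with
  | zero => simpa using eqOn_refl _ _
  | succ k ih =>
    rw [Function.iterate_succ, Function.comp_apply, Nat.cast_succ, ← add_assoc]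
    exact (eqOn_iterate_Dsub isOpen_Ioi (Dsub_Isub_add_one (by positivity) hf) k).trans ih

/-- Lemma 2.4: if `m − ν = n − μ` then `D_s^n [I_s^μ f] = D_s^m [I_s^ν f]`. -/
theorem substantial_derivative_integral_balance
    (σ a : ℝ) (m n : ℕ) (hm : 0 < m) (hn : 0 < n) (μ ν : ℝ) (hμ : 0 < μ) (hν : 0 < ν)
    (hbal : (m : ℝ) - ν = (n : ℝ) - μ) (f : ℝ → ℝ)
    (hf : ContDiffOn ℝ ((max m n : ℕ) - 1 : ℕ) f (Set.Ioi a))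
    (hint : ∀ b c : ℝ, a ≤ b → b ≤ c →
      IntervalIntegrable (iteratedDeriv (max m n) f) MeasureTheory.volume b c) :
    ∀ x > a, (Dsub σ)^[n] (Isub σ a μ f) x = (Dsub σ)^[m] (Isub σ a ν f) x := by
  intro x hx
  rcases le_total m n with h | h
  · obtain ⟨k, rfl⟩ := Nat.exists_eq_add_of_le h
    obtain rfl : μ = ν + k := by push_cast at hbal; linarith
    rw [Function.iterate_add_apply]
    exact eqOn_iterate_Dsub isOpen_Ioi (iterate_Dsub_Isub_add_natCast hν hf.continuousOn k) m hx
  · obtain ⟨k, rfl⟩ := Nat.exists_eq_add_of_le h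
    obtain rfl : ν = μ + k := by push_cast at hbal; linarith
    rw [Function.iterate_add_apply]
    exact (eqOn_iterate_Dsub isOpen_Ioi
      (iterate_Dsub_Isub_add_natCast hμ hf.continuousOn k) n hx).symm
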